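/- arXiv:1902.06319 — 3 statements merged into one kernel-verified Lean document; each statement's English description precedes it below -/
import Mathlib

section
/- Let F_q be a finite field with q elements, K ≥ 1, m = K(K+1)/2, and let L ≥ 5m. Let W_1,…,W_K be independent random vectors, each uniformly distributed on F_q^L. Then for every y ∈ F_q^m, the probability Pr{ (⟨W_i,W_j⟩)_{1≤i≤j≤K} = y } is strictly positive. -/
/-- Every element of a finite field is a sum of two squares. -/
theorem FiniteField.exists_mul_self_add_mul_self (F : Type*) [Field F] [Fintype F] (r : F) :
    ∃ a b : F, a * a + b * b = r := by
  classical
  by_cases h2 : ringChar F = 2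
  · obtain ⟨a, ha⟩ := FiniteField.isSquare_of_char_two h2 r
    exact ⟨a, 0, by simp [ha]⟩
  · obtain ⟨a, b, hab⟩ := FiniteField.exists_root_sum_quadratic
      (f := Polynomial.X ^ 2) (g := Polynomial.X ^ 2 - Polynomial.C r)
      (Polynomial.degree_X_pow 2)
      (Polynomial.degree_X_pow_sub_C (by norm_num) r)
      (FiniteField.odd_card_of_char_ne_two h2)
    refine ⟨a, b, ?_⟩
    simp only [Polynomial.eval_pow, Polynomial.eval_X, Polynomial.eval_sub,
      Polynomial.eval_C] at hab
    linear_combination hab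

/-- Over a finite field, the entries on and above the diagonal of a Gram matrix of `K` vectors
can be prescribed as soon as there are `K * K + K * 2` coordinates. -/
theorem exists_gram_eq (F : Type*) [Field F] [Fintype F] (K : ℕ) (y : Fin K → Fin K → F) :
    ∃ w : Fin K → (Fin K × Fin K) ⊕ (Fin K × Bool) → F,
      ∀ i j, i ≤ j → ∑ t, w i t * w j t = y i j := by
  classical
  let u : Fin K → Fin K × Fin K → F := fun i p =>
    if p.1 < p.2 then (if i = p.1 then 1 else if i = p.2 then y p.1 p.2 else 0) else 0
  choose a b hab using fun i =>
    FiniteField.exists_mul_self_add_mul_self F (y i i - ∑ p, u i p * u i p)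
  refine ⟨fun i => Sum.elim (u i)
    fun t => if i = t.1 then (if t.2 then a i else b i) else 0, fun i j hij => ?_⟩
  rw [Fintype.sum_sum_type]
  simp only [Sum.elim_inl, Sum.elim_inr]
  rcases hij.eq_or_lt with rfl | hlt
  · have h : ∑ t : Fin K × Bool, (if i = t.1 then (if t.2 then a i else b i) else 0) *
        (if i = t.1 then (if t.2 then a i else b i) else 0) = a i * a i + b i * b i := by
      rw [Fintype.sum_prod_type, Fintype.sum_eq_single i (fun k hk => by simp [hk.symm])]
      simp
    rw [h, hab]
    ring
  · have h : ∑ t : Fin K × Bool, (if i = t.1 then (if t.2 then a i else b i) else 0) *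
        (if j = t.1 then (if t.2 then a j else b j) else 0) = 0 := by
      refine Finset.sum_eq_zero fun t _ => ?_
      by_cases h1 : i = t.1
      · simp [← h1, hlt.ne']
      · simp [h1]
    rw [h, add_zero, Fintype.sum_eq_single (i, j)]
    · simp [u, hlt, hlt.ne']
    · rintro ⟨k, l⟩ hkl
      simp only [u]
      have hkl' : ¬ (k = i ∧ l = j) := by simpa using hkl
      split_ifs <;> first | (simp; done) | (exfalso; grind)

/-- In a finite field `F` with `q` elements, for `K ≥ 1`, `m = K(K+1)/2` and
`L ≥ 5m`, if `W_1,…,W_K` are independent uniform random vectors on `F^L` (equivalently, the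
tuple `(W_1,…,W_K)` is uniform on `(F^L)^K`), then for every `y ∈ F^m` the probability
`Pr{(⟨W_i,W_j⟩)_{1≤i≤j≤K} = y}` is strictly positive. -/
theorem stmt3 (F : Type*) [Field F] [Fintype F] (K L : ℕ) (hK : 1 ≤ K)
    (hL : 5 * (K * (K + 1) / 2) ≤ L)
    (y : {p : Fin K × Fin K // p.1 ≤ p.2} → F) :
    0 < (Nat.card {w : Fin K → Fin L → F //
          (fun p : {p : Fin K × Fin K // p.1 ≤ p.2} =>
            ∑ ℓ, w p.1.1 ℓ * w p.1.2 ℓ) = y} : ℝ)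
        / (Fintype.card (Fin K → Fin L → F) : ℝ) := by
  classical
  obtain ⟨w, hw⟩ := exists_gram_eq F K fun i j => if h : i ≤ j then y ⟨(i, j), h⟩ else 0
  have hcard : Fintype.card ((Fin K × Fin K) ⊕ (Fin K × Bool)) ≤ Fintype.card (Fin L) := by
    simp only [Fintype.card_sum, Fintype.card_prod, Fintype.card_fin, Fintype.card_bool]
    have h := Nat.div_mul_cancel (Nat.even_mul_succ_self K).two_dvd
    nlinarith
  obtain ⟨e⟩ := Function.Embedding.nonempty_of_card_le hcard
  have : Nonempty {w : Fin K → Fin L → F //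
      (fun p : {p : Fin K × Fin K // p.1 ≤ p.2} => ∑ ℓ, w p.1.1 ℓ * w p.1.2 ℓ) = y} := by
    refine ⟨fun i => Function.extend e (w i) 0, ?_⟩
    funext ⟨⟨i, j⟩, hij⟩
    have h := hw i j hij
    rw [dif_pos hij] at h
    rw [← h]
    refine (Fintype.sum_of_injective e e.injective _ _ (fun ℓ hℓ => ?_) fun t => ?_).symm
    · simp [Function.extend_apply' _ _ _ hℓ]
    · simp [e.injective.extend_apply]
  exact div_pos (Nat.cast_pos.2 Nat.card_pos) (Nat.cast_pos.2 Fintype.card_pos)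
end

section
/- Let F_q be a finite field with q elements, K ≥ 1, m = K(K+1)/2. For each L ≥ 1 let X^{(L)} be the Gram vector of K independent uniform random vectors on F_q^L. Then there exist a constant C ≥ 0 and a real number λ with 0 ≤ λ < 1 such that for every L ≥ 1 and every y ∈ F_q^m, |Pr{X^{(L)} = y} − q^{−m}| ≤ C·λ^{L−1}. -/
open Finset in
/-- A sum of unit complex numbers, two of which differ, has norm less than the number of terms. -/
theorem norm_sum_lt_card_of_ne {V : Type*} [Fintype V] (f : V → ℂ) (hf : ∀ v, ‖f v‖ = 1)
    {a b : V} (hab : f a ≠ f b) : ‖∑ v, f v‖ < Fintype.card V := by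
  classical
  have hne : b ≠ a := fun h => hab (by rw [h])
  have hb : b ∈ univ.erase a := by simp [hne]
  have hlt : ‖f a + f b‖ < 2 := by
    have hray : ¬ SameRay ℝ (f a) (f b) := fun h =>
      hab ((sameRay_iff_of_norm_eq (by rw [hf, hf])).1 h)
    have := norm_add_lt_of_not_sameRay hray
    rw [hf, hf] at this
    linarith
  have hrest : ‖∑ v ∈ (univ.erase a).erase b, f v‖ ≤ (Fintype.card V : ℝ) - 2 := by
    have hcard : #((univ.erase a).erase b) + 2 = Fintype.card V := by
      rw [← card_univ, ← card_erase_add_one (mem_univ a), ← card_erase_add_one hb]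
    calc ‖∑ v ∈ (univ.erase a).erase b, f v‖
        ≤ ∑ v ∈ (univ.erase a).erase b, ‖f v‖ := norm_sum_le _ _
      _ = (Fintype.card V : ℝ) - 2 := by
        rw [← hcard]
        simp [hf]
  rw [← add_sum_erase _ _ (mem_univ a), ← add_sum_erase _ _ hb, ← add_assoc]
  linarith [norm_add_le (f a + f b) (∑ v ∈ (univ.erase a).erase b, f v)]

/-- An additive character turns finite sums into finite products. -/
theorem AddChar.map_finset_sum_eq_prod {ι A M : Type*} [AddCommMonoid A] [CommMonoid M]
    (χ : AddChar A M) (s : Finset ι) (f : ι → A) : χ (∑ i ∈ s, f i) = ∏ i ∈ s, χ (f i) :=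
  map_prod χ.toMonoidHom (fun i => Multiplicative.ofAdd (f i)) s

open Finset in
/-- Fourier inversion for the number of ways to write `y` as a sum of `L` values of `g`. -/
theorem card_mul_card_sum_eq {A V : Type*} [AddCommGroup A] [Fintype A] [Fintype V]
    (g : V → A) (L : ℕ) (y : A) :
    (Fintype.card A : ℂ) * Nat.card {w : Fin L → V // ∑ l, g (w l) = y} =
      ∑ χ : AddChar A ℂ, χ (-y) * (∑ v, χ (g v)) ^ L := by
  classical
  have hpow (χ : AddChar A ℂ) : χ (-y) * (∑ v, χ (g v)) ^ L =
      ∑ w : Fin L → V, χ (∑ l, g (w l) - y) := by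
    rw [Fintype.sum_pow, mul_sum]
    refine sum_congr rfl fun w _ => ?_
    rw [sub_eq_add_neg, AddChar.map_add_eq_mul, AddChar.map_finset_sum_eq_prod, mul_comm]
  simp_rw [hpow]
  rw [sum_comm]
  simp_rw [AddChar.sum_apply_eq_ite, sub_eq_zero]
  rw [Nat.card_eq_fintype_card, Fintype.card_subtype, sum_ite]
  simp [mul_comm]

open Finset in
/-- A random walk on a finite abelian group whose steps `g v` include `0` and lie in the kernel of
no nontrivial character equidistributes exponentially fast. -/
theorem exists_abs_card_div_sub_le_pow {A V : Type*} [AddCommGroup A] [Fintype A] [Fintype V]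
    (g : V → A) {v₀ : V} (h₀ : g v₀ = 0)
    (hg : ∀ χ : AddChar A ℂ, (∀ v, χ (g v) = 1) → χ = 0) :
    ∃ r : ℝ, 0 ≤ r ∧ r < 1 ∧ ∀ (L : ℕ) (y : A),
      |(Nat.card {w : Fin L → V // ∑ l, g (w l) = y} : ℝ) / (Fintype.card V : ℝ) ^ L
        - 1 / (Fintype.card A : ℝ)| ≤ r ^ L := by
  classical
  have hV : (0 : ℝ) < Fintype.card V := by
    exact_mod_cast Fintype.card_pos_iff.2 ⟨v₀⟩
  have hA : (0 : ℝ) < Fintype.card A := by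
    exact_mod_cast Fintype.card_pos_iff.2 ⟨0⟩
  let φ : AddChar A ℂ → ℝ := fun χ => ‖∑ v, χ (g v)‖ / Fintype.card V
  have hφ (χ : AddChar A ℂ) (hχ : χ ≠ 0) : φ χ < 1 := by
    obtain ⟨v, hv⟩ : ∃ v, χ (g v) ≠ 1 := by
      by_contra! h
      exact hχ (hg χ h)
    refine (div_lt_one hV).2 (norm_sum_lt_card_of_ne _ (fun v => AddChar.norm_apply χ _)
      (a := v) (b := v₀) ?_)
    simpa [h₀] using hv
  obtain ⟨r, hr0, hr1, hr⟩ : ∃ r : ℝ, 0 ≤ r ∧ r < 1 ∧ ∀ χ : AddChar A ℂ, χ ≠ 0 → φ χ ≤ r := by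
    have hne : (insert 0 ((univ.erase (0 : AddChar A ℂ)).image φ)).Nonempty :=
      insert_nonempty _ _
    refine ⟨max' _ hne, le_max' _ _ (mem_insert_self _ _), ?_, fun χ hχ => le_max' _ _ ?_⟩
    · rw [max'_lt_iff]
      intro x hx
      simp only [mem_insert, mem_image, mem_erase, mem_univ, and_true] at hx
      rcases hx with rfl | ⟨χ, hχ, rfl⟩
      · exact zero_lt_one
      · exact hφ χ hχ
    · exact mem_insert_of_mem (mem_image_of_mem _ (by simp [hχ]))
  refine ⟨r, hr0, hr1, fun L y => ?_⟩
  set N := Nat.card {w : Fin L → V // ∑ l, g (w l) = y} with hN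
  have hFourier : (((N : ℝ) / (Fintype.card V : ℝ) ^ L - 1 / (Fintype.card A : ℝ) : ℝ) : ℂ) =
      (∑ χ ∈ univ.erase (0 : AddChar A ℂ), χ (-y) * (∑ v, χ (g v)) ^ L) /
        (Fintype.card A * (Fintype.card V : ℂ) ^ L) := by
    have hV' : (Fintype.card V : ℂ) ≠ 0 := by exact_mod_cast hV.ne'
    have hA' : (Fintype.card A : ℂ) ≠ 0 := by exact_mod_cast hA.ne'
    have h := card_mul_card_sum_eq g L y
    rw [← add_sum_erase _ _ (mem_univ 0), ← hN] at h
    simp only [AddChar.zero_apply, sum_const, card_univ, nsmul_eq_mul, mul_one, one_mul] at h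
    rw [eq_div_iff (by positivity)]
    push_cast
    field_simp
    linear_combination h
  have hcard : (#(univ.erase (0 : AddChar A ℂ)) : ℝ) ≤ Fintype.card A := by
    have := (card_erase_le (s := univ) (a := (0 : AddChar A ℂ)))
    rw [card_univ, AddChar.card_eq] at this
    exact_mod_cast this
  have hsum : ‖∑ χ ∈ univ.erase (0 : AddChar A ℂ), χ (-y) * (∑ v, χ (g v)) ^ L‖ ≤
      Fintype.card A * (r * Fintype.card V) ^ L := by
    refine (norm_sum_le_of_le _ (f := fun χ : AddChar A ℂ => χ (-y) * (∑ v, χ (g v)) ^ L)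
      (n := fun _ => (r * Fintype.card V) ^ L) fun χ hχ => ?_).trans ?_
    · rw [norm_mul, AddChar.norm_apply, one_mul, norm_pow]
      exact pow_le_pow_left₀ (norm_nonneg _)
        ((div_le_iff₀ hV).1 (hr χ (ne_of_mem_erase hχ))) L
    · rw [sum_const, nsmul_eq_mul]
      gcongr
  rw [← Real.norm_eq_abs, ← Complex.norm_real, hFourier, norm_div, div_le_iff₀ (by
    rw [norm_mul, norm_pow, Complex.norm_natCast, Complex.norm_natCast]; positivity)]
  rw [norm_mul, norm_pow, Complex.norm_natCast, Complex.norm_natCast]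
  calc _ ≤ _ := hsum
    _ = _ := by ring

/-- The squares of a finite field lie in the kernel of no nontrivial additive character. -/
theorem AddChar.eq_zero_of_forall_map_sq_eq_one {F M : Type*} [Field F] [Finite F]
    [DivisionCommMonoid M] (χ : AddChar F M) (hχ : ∀ t, χ (t ^ 2) = 1) : χ = 0 := by
  ext c
  rw [AddChar.zero_apply]
  by_cases h2 : ringChar F = 2
  · obtain ⟨t, rfl⟩ := FiniteField.isSquare_of_char_two h2 c
    simpa [sq] using hχ t
  · have h : (2 : F) ≠ 0 := Ring.two_ne_zero h2
    have hc : c = ((c + 1) / 2) ^ 2 - ((c - 1) / 2) ^ 2 := by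
      field_simp
      ring
    rw [hc, AddChar.map_sub_eq_div, hχ, hχ, div_one]

/-- The products `(vᵢ vⱼ)_{i ≤ j}` lie in the kernel of no nontrivial additive character. -/
theorem AddChar.eq_zero_of_forall_map_mul_eq_one {F ι M : Type*} [Field F] [Finite F] [Fintype ι]
    [LinearOrder ι] [DivisionCommMonoid M] (χ : AddChar ({p : ι × ι // p.1 ≤ p.2} → F) M)
    (hχ : ∀ v : ι → F, χ (fun p => v p.1.1 * v p.1.2) = 1) : χ = 0 := by
  have hdiag (i : ι) (c : F) : χ (Pi.single ⟨(i, i), le_rfl⟩ c) = 1 := by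
    let ψ : AddChar F M := χ.compAddMonoidHom
      (AddMonoidHom.single (fun _ : {p : ι × ι // p.1 ≤ p.2} => F) ⟨(i, i), le_rfl⟩)
    have hψ : ψ = 0 := ψ.eq_zero_of_forall_map_sq_eq_one fun t => by
      rw [← hχ (Pi.single i t)]
      change χ (Pi.single _ _) = _
      congr 1
      ext ⟨⟨a, b⟩, hab⟩
      simp only [Pi.single_apply, Subtype.mk.injEq, Prod.mk.injEq]
      split_ifs <;> simp_all [sq]
    exact DFunLike.congr_fun hψ c
  have hoff (p : {p : ι × ι // p.1 ≤ p.2}) (c : F) : χ (Pi.single p c) = 1 := by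
    obtain ⟨⟨i, j⟩, hij : i ≤ j⟩ := p
    obtain rfl | hlt := hij.eq_or_lt
    · exact hdiag i c
    have hv := hχ (Pi.single i 1 + Pi.single j c)
    have hsplit : (fun p : {p : ι × ι // p.1 ≤ p.2} =>
          (Pi.single i 1 + Pi.single j c : ι → F) p.1.1 *
            (Pi.single i 1 + Pi.single j c : ι → F) p.1.2) =
        Pi.single ⟨(i, i), le_rfl⟩ 1 + Pi.single ⟨(j, j), le_rfl⟩ (c ^ 2) +
          Pi.single ⟨(i, j), hij⟩ c := by
      ext ⟨⟨a, b⟩, hab : a ≤ b⟩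
      have hji : ¬ (a = j ∧ b = i) := by
        rintro ⟨rfl, rfl⟩
        exact hab.not_gt hlt
      simp only [Pi.add_apply, Pi.single_apply, Subtype.mk.injEq, Prod.mk.injEq]
      have := hlt.ne
      by_cases h1 : a = i <;> by_cases h2 : a = j <;> by_cases h3 : b = i <;>
        by_cases h4 : b = j <;> simp_all [sq]
    rwa [hsplit, AddChar.map_add_eq_mul, AddChar.map_add_eq_mul, hdiag, hdiag, one_mul,
      one_mul] at hv
  ext x
  rw [← Finset.univ_sum_single x, AddChar.map_finset_sum_eq_prod, AddChar.zero_apply]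
  exact Finset.prod_eq_one fun p _ => hoff p _

/-- The number of pairs `i ≤ j` in a finite linear order. -/
theorem Fintype.card_subtype_fst_le_snd (ι : Type*) [Fintype ι] [LinearOrder ι] :
    Fintype.card {p : ι × ι // p.1 ≤ p.2} = Fintype.card ι * (Fintype.card ι + 1) / 2 := by
  rw [← Fintype.card_congr Sym2.sortEquiv, Sym2.card, Nat.choose_two_right, Nat.add_sub_cancel,
    mul_comm]


/-- Lemma 4: With `X^{(L)}` the Gram vector of `K` independent uniform random
vectors on `F^L` (`F` a finite field with `q` elements, `m = K(K+1)/2`), there exist `C ≥ 0`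
and `λ ∈ [0,1)` such that for every `L ≥ 1` and every `y ∈ F^m`,
`|Pr{X^{(L)} = y} − q^{−m}| ≤ C·λ^{L−1}`. -/
theorem stmt6 (F : Type*) [Field F] [Fintype F] (K : ℕ) (hK : 1 ≤ K) :
    ∃ C : ℝ, 0 ≤ C ∧ ∃ lam : ℝ, 0 ≤ lam ∧ lam < 1 ∧
      ∀ L : ℕ, 1 ≤ L → ∀ y : {p : Fin K × Fin K // p.1 ≤ p.2} → F,
        |(Nat.card {w : Fin K → Fin L → F //
              (fun p : {p : Fin K × Fin K // p.1 ≤ p.2} =>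
                ∑ ℓ, w p.1.1 ℓ * w p.1.2 ℓ) = y} : ℝ)
            / (Fintype.card (Fin K → Fin L → F) : ℝ)
          - 1 / (Fintype.card F : ℝ) ^ (K * (K + 1) / 2)|
        ≤ C * lam ^ (L - 1) := by
  classical
  obtain ⟨r, hr0, hr1, hr⟩ := exists_abs_card_div_sub_le_pow
    (fun (v : Fin K → F) (p : {p : Fin K × Fin K // p.1 ≤ p.2}) => v p.1.1 * v p.1.2)
    (v₀ := 0) (by ext; simp) AddChar.eq_zero_of_forall_map_mul_eq_one
  refine ⟨1, zero_le_one, r, hr0, hr1, fun L _ y => ?_⟩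
  have hcard : Nat.card {w : Fin K → Fin L → F //
        (fun p : {p : Fin K × Fin K // p.1 ≤ p.2} => ∑ ℓ, w p.1.1 ℓ * w p.1.2 ℓ) = y} =
      Nat.card {w : Fin L → Fin K → F //
        ∑ ℓ, (fun p : {p : Fin K × Fin K // p.1 ≤ p.2} => w ℓ p.1.1 * w ℓ p.1.2) = y} :=
    Nat.card_congr ((Equiv.piComm fun _ _ => F).subtypeEquiv fun w => by
      simp [funext_iff, Finset.sum_apply])
  have hspace : (Fintype.card (Fin K → Fin L → F) : ℝ) =
      (Fintype.card (Fin K → F) : ℝ) ^ L := by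
    simp [← pow_mul, mul_comm]
  have htarget : (Fintype.card F : ℝ) ^ (K * (K + 1) / 2) =
      (Fintype.card ({p : Fin K × Fin K // p.1 ≤ p.2} → F) : ℝ) := by
    rw [Fintype.card_fun, Fintype.card_subtype_fst_le_snd, Fintype.card_fin, Nat.cast_pow]
  rw [hcard, hspace, htarget, one_mul]
  exact (hr L y).trans (pow_le_pow_of_le_one hr0 hr1.le (Nat.sub_le L 1))
end

section
/- Let F_q be a finite field with q elements, K ≥ 1, m = K(K+1)/2, and let 𝒫 be a set of P unordered pairs {i,j} with i,j ∈ {1,…,K}. For each L ≥ 1 let X^{(L)}_𝒫 = (⟨W_i,W_j⟩)_{\{i,j\}∈𝒫} ∈ F_q^P, where W_1,…,W_K are independent uniform random vectors on F_q^L. Then there exist C ≥ 0 and λ ∈ [0,1) such that for every L ≥ 1 and every z ∈ F_q^P, |Pr{X^{(L)}_𝒫 = z} − q^{−P}| ≤ C·λ^{L−1}. -/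
open Finset in
/-- A sum of unit complex numbers, one of which is `1` and another of which is not, has norm
strictly less than the number of terms. -/
theorem norm_sum_unit_lt_card {Ω : Type*} [Fintype Ω] {f : Ω → ℂ} (hf : ∀ v, ‖f v‖ = 1)
    {a b : Ω} (ha : f a = 1) (hb : f b ≠ 1) : ‖∑ v, f v‖ < Fintype.card Ω := by
  classical
  have hab : a ∈ univ.erase b := by
    refine mem_erase.2 ⟨?_, mem_univ _⟩
    rintro rfl
    exact hb ha
  have hray : ¬ SameRay ℝ (f b) (f a) := fun h =>
    hb ((h.eq_of_norm_eq (by rw [hf, hf])).trans ha)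
  have h2 : ‖f b + f a‖ < 2 := by
    have := norm_add_lt_of_not_sameRay hray
    rw [hf, hf] at this
    linarith
  have hsum : ∑ v, f v = (f b + f a) + ∑ v ∈ (univ.erase b).erase a, f v := by
    rw [← add_sum_erase _ _ (mem_univ b), ← add_sum_erase _ _ hab, add_assoc]
  have hrest : ‖∑ v ∈ (univ.erase b).erase a, f v‖ ≤ ((univ.erase b).erase a).card := by
    refine (norm_sum_le _ _).trans ?_
    simp [hf]
  have hcard : ((univ.erase b).erase a).card + 2 = Fintype.card Ω := by
    have h1 := card_erase_add_one hab
    have h2 := card_erase_add_one (mem_univ b)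
    rw [card_univ] at h2
    omega
  have hcard' : (((univ.erase b).erase a).card : ℝ) + 2 = Fintype.card Ω := by exact_mod_cast hcard
  rw [hsum]
  have := norm_add_le (f b + f a) (∑ v ∈ (univ.erase b).erase a, f v)
  linarith

/-- Fourier inversion for the number of ways to write `z` as a sum of `L` values of `φ`. -/
theorem card_sum_eq_mul_card {G Ω : Type*} [AddCommGroup G] [Fintype G] [Fintype Ω]
    (φ : Ω → G) (L : ℕ) (z : G) :
    (Nat.card {w : Fin L → Ω // ∑ l, φ (w l) = z} : ℂ) * Fintype.card G
      = ∑ ψ : AddChar G ℂ, ψ (-z) * (∑ v, ψ (φ v)) ^ L := by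
  classical
  have h (w : Fin L → Ω) : (∑ ψ : AddChar G ℂ, ψ (∑ l, φ (w l) - z))
      = if ∑ l, φ (w l) = z then (Fintype.card G : ℂ) else 0 := by
    rw [AddChar.sum_apply_eq_ite]
    simp only [sub_eq_zero]
  calc (Nat.card {w : Fin L → Ω // ∑ l, φ (w l) = z} : ℂ) * Fintype.card G
      = ∑ w : Fin L → Ω, if ∑ l, φ (w l) = z then (Fintype.card G : ℂ) else 0 := by
        rw [← Finset.sum_filter, Finset.sum_const, Nat.card_eq_fintype_card, Fintype.card_subtype,
          nsmul_eq_mul]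
    _ = ∑ w : Fin L → Ω, ∑ ψ : AddChar G ℂ, ψ (∑ l, φ (w l) - z) :=
        Finset.sum_congr rfl fun w _ => (h w).symm
    _ = ∑ ψ : AddChar G ℂ, ψ (-z) * (∑ v, ψ (φ v)) ^ L := by
        rw [Finset.sum_comm]
        refine Finset.sum_congr rfl fun ψ _ => ?_
        rw [Fintype.sum_pow, Finset.mul_sum]
        refine Finset.sum_congr rfl fun w _ => ?_
        rw [sub_eq_add_neg, add_comm, AddChar.map_add_eq_mul]
        congr 1
        exact map_prod ψ.toMonoidHom (fun l => Multiplicative.ofAdd (φ (w l))) Finset.univ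

/-- Sums of independent copies of a random variable in a finite abelian group, whose values
contain `0` and generate the group, become uniform exponentially fast. -/
theorem exists_abs_card_sum_eq_div_sub_le {G Ω : Type*} [AddCommGroup G] [Fintype G] [Fintype Ω]
    (φ : Ω → G) (h0 : ∃ v, φ v = 0) (hφ : AddSubgroup.closure (Set.range φ) = ⊤) :
    ∃ lam : ℝ, 0 ≤ lam ∧ lam < 1 ∧ ∀ (L : ℕ) (z : G),
      |(Nat.card {w : Fin L → Ω // ∑ l, φ (w l) = z} : ℝ) / (Fintype.card Ω : ℝ) ^ L
        - 1 / (Fintype.card G : ℝ)| ≤ lam ^ L := by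
  classical
  obtain ⟨a, ha⟩ := h0
  have : Nonempty Ω := ⟨a⟩
  have hΩ : (0 : ℝ) < Fintype.card Ω := by exact_mod_cast Fintype.card_pos
  have hG : (0 : ℝ) < Fintype.card G := by exact_mod_cast Fintype.card_pos
  have hlt (ψ : AddChar G ℂ) (hψ : ψ ≠ 0) : ‖∑ v, ψ (φ v)‖ < Fintype.card Ω := by
    obtain ⟨b, hb⟩ : ∃ b, ψ (φ b) ≠ 1 := by
      by_contra! hall
      refine hψ (DFunLike.ext _ _ fun g => ?_)
      have hg : g ∈ AddSubgroup.closure (Set.range φ) := hφ ▸ AddSubgroup.mem_top g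
      rw [AddChar.zero_apply]
      induction hg using AddSubgroup.closure_induction with
      | mem x hx => obtain ⟨v, rfl⟩ := hx; exact hall v
      | zero => exact AddChar.map_zero_eq_one ψ
      | add x y _ _ hx hy => rw [AddChar.map_add_eq_mul, hx, hy, one_mul]
      | neg x _ hx => rw [AddChar.map_neg_eq_inv, hx, inv_one]
    exact norm_sum_unit_lt_card (fun v => AddChar.norm_apply ψ _)
      (a := a) (by rw [ha, AddChar.map_zero_eq_one]) hb
  let g : AddChar G ℂ → ℝ := fun ψ => if ψ = 0 then 0 else ‖∑ v, ψ (φ v)‖ / Fintype.card Ω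
  obtain ⟨ψ₀, hψ₀⟩ := Finite.exists_max g
  have hg0 : g 0 = 0 := if_pos rfl
  refine ⟨g ψ₀, hg0 ▸ hψ₀ 0, ?_, fun L z => ?_⟩
  · by_cases h : ψ₀ = 0
    · rw [h, hg0]; exact one_pos
    · simp only [g, if_neg h]
      exact (div_lt_one hΩ).2 (hlt ψ₀ h)
  have hbound (ψ : AddChar G ℂ) (hψ : ψ ≠ 0) :
      ‖ψ (-z) * (∑ v, ψ (φ v)) ^ L‖ ≤ (g ψ₀ * Fintype.card Ω) ^ L := by
    rw [norm_mul, AddChar.norm_apply, one_mul, norm_pow]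
    have := hψ₀ ψ
    simp only [g, if_neg hψ] at this
    exact pow_le_pow_left₀ (norm_nonneg _) ((div_le_iff₀ hΩ).1 this) _
  set N := Nat.card {w : Fin L → Ω // ∑ l, φ (w l) = z} with hN
  have hdiff : (N : ℂ) * Fintype.card G - (Fintype.card Ω : ℂ) ^ L
      = ∑ ψ ∈ Finset.univ.erase (0 : AddChar G ℂ), ψ (-z) * (∑ v, ψ (φ v)) ^ L := by
    rw [hN, card_sum_eq_mul_card, ← Finset.add_sum_erase _ _ (Finset.mem_univ 0)]
    simp
  have hnorm : |(N : ℝ) * Fintype.card G - (Fintype.card Ω : ℝ) ^ L|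
      ≤ Fintype.card G * (g ψ₀ * Fintype.card Ω) ^ L := by
    have hcast : (((N : ℝ) * Fintype.card G - (Fintype.card Ω : ℝ) ^ L : ℝ) : ℂ)
        = (N : ℂ) * Fintype.card G - (Fintype.card Ω : ℂ) ^ L := by push_cast; rfl
    rw [← Real.norm_eq_abs, ← Complex.norm_real, hcast, hdiff]
    have hpow : 0 ≤ (g ψ₀ * Fintype.card Ω) ^ L :=
      pow_nonneg (mul_nonneg (hg0 ▸ hψ₀ 0) hΩ.le) _
    calc _ ≤ ∑ ψ ∈ Finset.univ.erase (0 : AddChar G ℂ), (g ψ₀ * Fintype.card Ω) ^ L :=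
          norm_sum_le_of_le _ fun ψ hψ => hbound ψ (Finset.ne_of_mem_erase hψ)
      _ ≤ ∑ ψ : AddChar G ℂ, (g ψ₀ * Fintype.card Ω) ^ L :=
          Finset.sum_le_sum_of_subset_of_nonneg (Finset.erase_subset _ _) fun _ _ _ => hpow
      _ = _ := by rw [Finset.sum_const, Finset.card_univ, AddChar.card_eq, nsmul_eq_mul]
  have hΩL : (0 : ℝ) < (Fintype.card Ω : ℝ) ^ L := pow_pos hΩ L
  rw [div_sub_div _ _ hΩL.ne' hG.ne', mul_one, abs_div, abs_of_pos (mul_pos hΩL hG),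
    div_le_iff₀ (mul_pos hΩL hG)]
  calc _ ≤ _ := hnorm
    _ = _ := by rw [mul_pow]; ring

/-- Every element of a finite field is a sum of two squares. -/
theorem FiniteField.exists_sq_add_sq_eq {F : Type*} [Field F] [Finite F] (x : F) :
    ∃ a b : F, a ^ 2 + b ^ 2 = x := by
  have := Fintype.ofFinite F
  by_cases h2 : ringChar F = 2
  · obtain ⟨a, ha⟩ := FiniteField.isSquare_of_char_two h2 x
    exact ⟨a, 0, by rw [ha]; ring⟩
  · obtain ⟨a, b, hab⟩ := FiniteField.exists_root_sum_quadratic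
      (f := (Polynomial.X ^ 2 : Polynomial F)) (g := Polynomial.X ^ 2 - Polynomial.C x)
      (Polynomial.degree_X_pow 2) (Polynomial.degree_X_pow_sub_C two_pos x)
      (FiniteField.odd_card_of_char_ne_two h2)
    refine ⟨a, b, ?_⟩
    simp only [Polynomial.eval_pow, Polynomial.eval_X, Polynomial.eval_sub,
      Polynomial.eval_C] at hab
    linear_combination hab

/-- The vectors of quadratic monomials `x_i x_j`, for any set of pairs `i ≤ j`, additively generate
the whole space over a finite field. -/
theorem closure_range_quadratic_monomials {F : Type*} [Field F] [Finite F] {K : ℕ}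
    (Ps : Finset {p : Fin K × Fin K // p.1 ≤ p.2}) :
    AddSubgroup.closure (Set.range fun (v : Fin K → F) (s : ↥Ps) => v s.1.1.1 * v s.1.1.2) = ⊤ := by
  classical
  set φ : (Fin K → F) → ↥Ps → F := fun v s => v s.1.1.1 * v s.1.1.2 with hφ
  have hmem (v : Fin K → F) : φ v ∈ AddSubgroup.closure (Set.range φ) :=
    AddSubgroup.subset_closure ⟨v, rfl⟩
  have hsingle (s : ↥Ps) (x : F) : Pi.single s x ∈ AddSubgroup.closure (Set.range φ) := by
    obtain ⟨⟨⟨i, j⟩, hij⟩, hs⟩ := s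
    obtain rfl | hne := eq_or_ne i j
    · obtain ⟨a, b, rfl⟩ := FiniteField.exists_sq_add_sq_eq x
      convert add_mem (hmem (Pi.single i a)) (hmem (Pi.single i b)) using 1
      ext ⟨⟨⟨k, l⟩, hkl⟩, ht⟩
      simp only [hφ, Pi.add_apply, Pi.single_apply, Subtype.mk.injEq, Prod.mk.injEq]
      by_cases hk : k = i <;> by_cases hl : l = i <;> simp [hk, hl, sq]
    · convert sub_mem (sub_mem (hmem (Pi.single i x + Pi.single j 1)) (hmem (Pi.single i x)))
        (hmem (Pi.single j 1)) using 1
      ext ⟨⟨⟨k, l⟩, hkl⟩, ht⟩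
      simp only [hφ, Pi.add_apply, Pi.sub_apply, Pi.single_apply, Subtype.mk.injEq, Prod.mk.injEq]
      have hcross : ¬ (k = j ∧ l = i) := by
        rintro ⟨rfl, rfl⟩
        exact hne (le_antisymm hij hkl)
      by_cases hk : k = i <;> by_cases hl : l = j <;> by_cases hk' : k = j <;>
        by_cases hl' : l = i <;> simp_all
  refine (AddSubgroup.eq_top_iff' _).2 fun z => ?_
  rw [← Finset.univ_sum_single z]
  exact sum_mem fun s _ => hsingle s _


/-- Let `Ps` be a set of `P` unordered pairs `{i,j}` with `i,j ∈ {1,…,K}`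
(represented as pairs `(i,j)` with `i ≤ j`).  With `X^{(L)}_Ps = (⟨W_i,W_j⟩)_{{i,j}∈Ps}`
for `W_1,…,W_K` independent uniform on `F^L`, there exist `C ≥ 0` and `λ ∈ [0,1)` such that
for every `L ≥ 1` and every `z ∈ F^P`, `|Pr{X^{(L)}_Ps = z} − q^{−P}| ≤ C·λ^{L−1}`. -/
theorem stmt7 (F : Type*) [Field F] [Fintype F] (K P : ℕ) (hK : 1 ≤ K)
    (Ps : Finset {p : Fin K × Fin K // p.1 ≤ p.2}) (hP : Ps.card = P) :
    ∃ C : ℝ, 0 ≤ C ∧ ∃ lam : ℝ, 0 ≤ lam ∧ lam < 1 ∧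
      ∀ L : ℕ, 1 ≤ L → ∀ z : ↥Ps → F,
        |(Nat.card {w : Fin K → Fin L → F //
              (fun s : ↥Ps => ∑ ℓ, w s.1.1.1 ℓ * w s.1.1.2 ℓ) = z} : ℝ)
            / (Fintype.card (Fin K → Fin L → F) : ℝ)
          - 1 / (Fintype.card F : ℝ) ^ P|
        ≤ C * lam ^ (L - 1) := by
  classical
  obtain ⟨lam, h0, h1, h⟩ := exists_abs_card_sum_eq_div_sub_le
    (fun (v : Fin K → F) (s : ↥Ps) => v s.1.1.1 * v s.1.1.2)
    ⟨0, by ext s; simp⟩ (closure_range_quadratic_monomials Ps)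
  refine ⟨1, zero_le_one, lam, h0, h1, fun L _ z => ?_⟩
  have hcard : Nat.card {w : Fin K → Fin L → F //
        (fun s : ↥Ps => ∑ ℓ, w s.1.1.1 ℓ * w s.1.1.2 ℓ) = z}
      = Nat.card {w : Fin L → Fin K → F //
        ∑ ℓ, (fun s : ↥Ps => w ℓ s.1.1.1 * w ℓ s.1.1.2) = z} := by
    refine Nat.card_congr ((Equiv.piComm fun _ _ => F).subtypeEquiv fun w => ?_)
    simp only [funext_iff, Finset.sum_apply, Equiv.piComm_apply, Function.swap]
  have hΩ : (Fintype.card (Fin K → Fin L → F) : ℝ) = (Fintype.card (Fin K → F) : ℝ) ^ L := by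
    simp only [Fintype.card_fun, Fintype.card_fin, Nat.cast_pow, ← pow_mul, mul_comm]
  have hG : (Fintype.card (↥Ps → F) : ℝ) = (Fintype.card F : ℝ) ^ P := by
    simp [hP]
  rw [hcard, hΩ, ← hG, one_mul]
  exact (h L z).trans (pow_le_pow_of_le_one h0 h1.le (Nat.sub_le L 1))
end
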